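/- arXiv:2011.08580 — 6 statements merged into one kernel-verified Lean document; each statement's English description precedes it below -/
import Mathlib

section
/- Assume Γ ≠ Γ_n and let f : Γ → ℝ be a smooth symmetric concave function satisfying condition (1.8). Let α_1,…,α_n be strictly positive constants such that (−α_1,…,−α_{κ_Γ}, α_{κ_Γ+1},…,α_n) ∈ Γ and α_1 ≥ α_2 ≥ ⋯ ≥ α_{κ_Γ}. Then for each λ ∈ Γ with λ_1 ≤ λ_2 ≤ ⋯ ≤ λ_n one has f_{κ_Γ+1}(λ) ≥ [α_1 / (Σ_{i=κ_Γ+1}^n α_i − Σ_{i=2}^{κ_Γ} α_i)] · f_1(λ). Furthermore f_1(λ) ≥ (1/n) Σ_{i=1}^n f_i(λ). -/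
open Filter

noncomputable section

/-- The `j`-th elementary symmetric polynomial of `lam : Fin n → ℝ`. -/
def esymmR (n j : ℕ) (lam : Fin n → ℝ) : ℝ :=
  ∑ s ∈ Finset.univ.powersetCard j, ∏ i ∈ s, lam i

/-- The `k`-th Gårding cone `Γ_k ⊆ ℝⁿ`:
    `{λ : σ_j(λ) > 0 for all 1 ≤ j ≤ k}`. -/
def gardingCone (n k : ℕ) : Set (Fin n → ℝ) :=
  {lam | ∀ j, 1 ≤ j → j ≤ k → 0 < esymmR n j lam}

/-- `Γ` is an open symmetric convex cone with vertex at the origin,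
    nonempty boundary, and `Γ_n ⊆ Γ ⊆ Γ_1`. -/
structure IsGoodCone (n : ℕ) (Γ : Set (Fin n → ℝ)) : Prop where
  isOpen : IsOpen Γ
  symm : ∀ σ : Equiv.Perm (Fin n), ∀ lam ∈ Γ, (lam ∘ σ) ∈ Γ
  convex : Convex ℝ Γ
  cone : ∀ t : ℝ, 0 < t → ∀ lam ∈ Γ, t • lam ∈ Γ
  frontier_nonempty : (frontier Γ).Nonempty
  posCone_subset : gardingCone n n ⊆ Γ
  subset_cone_one : Γ ⊆ gardingCone n 1

/-- The partial derivative `f_i(λ) = ∂f/∂λ_i (λ)`. -/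
def pder (n : ℕ) (f : (Fin n → ℝ) → ℝ) (i : Fin n) (lam : Fin n → ℝ) : ℝ :=
  deriv (fun t : ℝ => f (fun j => if j = i then lam j + t else lam j)) 0

/-- `f` is smooth, symmetric and concave on `Γ`. -/
structure IsGoodF (n : ℕ) (Γ : Set (Fin n → ℝ)) (f : (Fin n → ℝ) → ℝ) : Prop where
  smooth : ContDiffOn ℝ (⊤ : ℕ∞) f Γ
  symm : ∀ σ : Equiv.Perm (Fin n), ∀ lam ∈ Γ, f (lam ∘ σ) = f lam
  concave : ConcaveOn ℝ Γ f

/-- Condition (1.8): for each `σ < sup_Γ f` and each `λ ∈ Γ`,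
    `lim_{t → +∞} f(tλ) > σ`. -/
def Cond18 (n : ℕ) (Γ : Set (Fin n → ℝ)) (f : (Fin n → ℝ) → ℝ) : Prop :=
  ∀ σ : ℝ, (∃ μ ∈ Γ, σ < f μ) → ∀ lam ∈ Γ, ∀ᶠ t : ℝ in atTop, σ < f (t • lam)

/-- Condition (1.9): `f_i ≥ 0` for all `i` and `Σ f_i > 0` on `Γ`. -/
def Cond19 (n : ℕ) (Γ : Set (Fin n → ℝ)) (f : (Fin n → ℝ) → ℝ) : Prop :=
  ∀ lam ∈ Γ, (∀ i, 0 ≤ pder n f i lam) ∧ 0 < ∑ i, pder n f i lam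

/-- `κ_Γ`: the largest `l` such that some vector with exactly the first `l`
    entries negative (and the rest positive) belongs to `Γ`. -/
def kappa (n : ℕ) (Γ : Set (Fin n → ℝ)) : ℕ :=
  sSup {l : ℕ | ∃ α : Fin n → ℝ, (∀ i, 0 < α i) ∧
    (fun i : Fin n => if (i : ℕ) < l then -α i else α i) ∈ Γ}

/-- `f` is of `m`-uniform ellipticity. -/
def UniformlyElliptic (n m : ℕ) (Γ : Set (Fin n → ℝ)) (f : (Fin n → ℝ) → ℝ) : Prop :=
  Cond19 n Γ f ∧ ∃ θ : ℝ, 0 < θ ∧ ∀ lam ∈ Γ, Monotone lam →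
    ∀ i : Fin n, (i : ℕ) < m → θ * ∑ j, pder n f j lam ≤ pder n f i lam


lemma aux_pder {n : ℕ} {f : (Fin n → ℝ) → ℝ} {lam : Fin n → ℝ} (hd : DifferentiableAt ℝ f lam)
    (i : Fin n) : pder n f i lam = fderiv ℝ f lam (Pi.single i 1) := by
  have h1 : HasDerivAt (fun t : ℝ => lam + t • (Pi.single i 1 : Fin n → ℝ)) (Pi.single i 1) 0 := by
    simpa using ((hasDerivAt_id (0 : ℝ)).smul_const (Pi.single i 1 : Fin n → ℝ)).const_add lam
  have h2 : HasFDerivAt f (fderiv ℝ f lam) (lam + (0 : ℝ) • (Pi.single i 1 : Fin n → ℝ)) := by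
    simpa using hd.hasFDerivAt
  have h3 := (h2.comp_hasDerivAt (0 : ℝ) h1).deriv
  rw [← h3]
  unfold pder
  congr 1
  funext t
  simp only [Function.comp]
  congr 1
  funext j
  by_cases h : j = i
  · subst h; simp
  · simp [h]

lemma aux_lin {n : ℕ} {f : (Fin n → ℝ) → ℝ} {lam : Fin n → ℝ} (hd : DifferentiableAt ℝ f lam)
    (v : Fin n → ℝ) : fderiv ℝ f lam v = ∑ i, v i * pder n f i lam := by
  conv_lhs => rw [pi_eq_sum_univ' v]
  rw [map_sum]
  refine Finset.sum_congr rfl fun i _ => ?_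
  rw [map_smul, aux_pder hd, smul_eq_mul]


lemma aux_conc {n : ℕ} {Γ : Set (Fin n → ℝ)} {f : (Fin n → ℝ) → ℝ} (hc : ConcaveOn ℝ Γ f)
    {lam mu : Fin n → ℝ} (hd : DifferentiableAt ℝ f lam) (hl : lam ∈ Γ) (hm : mu ∈ Γ) :
    f mu ≤ f lam + fderiv ℝ f lam (mu - lam) := by
  have h1 : HasDerivAt (fun t : ℝ => lam + t • (mu - lam)) (mu - lam) 0 := by
    simpa using ((hasDerivAt_id (0 : ℝ)).smul_const (mu - lam)).const_add lam
  have h2 : HasFDerivAt f (fderiv ℝ f lam) (lam + (0 : ℝ) • (mu - lam)) := by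
    simpa using hd.hasFDerivAt
  have h3 := (h2.comp_hasDerivAt (0 : ℝ) h1).tendsto_slope_zero_right
  have h4 : f mu - f lam ≤ fderiv ℝ f lam (mu - lam) := by
    refine ge_of_tendsto h3 ?_
    filter_upwards [Ioo_mem_nhdsGT (show (0 : ℝ) < 1 by norm_num)] with t ht
    have h5 := hc.2 hl hm (show (0 : ℝ) ≤ 1 - t by linarith [ht.2]) ht.1.le (by ring)
    have h6 : (1 - t) • lam + t • mu = lam + t • (mu - lam) := by
      rw [smul_sub, sub_smul, one_smul]; abel
    rw [h6] at h5
    simp only [smul_eq_mul] at h5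
    simp only [Function.comp, zero_add, zero_smul, add_zero, smul_eq_mul]
    rw [← div_eq_inv_mul, le_div_iff₀ ht.1]
    linarith
  linarith

lemma aux_nonneg {n : ℕ} {Γ : Set (Fin n → ℝ)} (hΓ : IsGoodCone n Γ) {f : (Fin n → ℝ) → ℝ}
    (hc : ConcaveOn ℝ Γ f) (h18 : Cond18 n Γ f)
    {lam mu : Fin n → ℝ} (hd : DifferentiableAt ℝ f lam) (hl : lam ∈ Γ) (hm : mu ∈ Γ) :
    0 ≤ fderiv ℝ f lam mu := by
  by_contra hneg
  push Not at hneg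
  have h1 := h18 (f lam - 1) ⟨lam, hl, by linarith⟩ mu hm
  have h2 : Tendsto (fun t : ℝ => t * (fderiv ℝ f lam mu)) atTop atBot :=
    tendsto_id.atTop_mul_const_of_neg hneg
  have h3 := h2.eventually (eventually_lt_atBot (fderiv ℝ f lam lam - 1))
  obtain ⟨t, ht1, ht2, ht0⟩ := (h1.and (h3.and (eventually_gt_atTop (0 : ℝ)))).exists
  have h4 := aux_conc hc hd hl (hΓ.cone t ht0 mu hm)
  rw [map_sub, map_smul, smul_eq_mul] at h4
  linarith

lemma aux_anti {n : ℕ} {Γ : Set (Fin n → ℝ)} (hΓ : IsGoodCone n Γ) {f : (Fin n → ℝ) → ℝ}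
    (hf : IsGoodF n Γ f) {lam : Fin n → ℝ} (hd : DifferentiableAt ℝ f lam) (hl : lam ∈ Γ)
    {i j : Fin n} (hij : lam i ≤ lam j) : pder n f j lam ≤ pder n f i lam := by
  rcases eq_or_ne i j with rfl | hne
  · exact le_rfl
  rcases hij.lt_or_eq with hlt | heq
  · have h1 := aux_conc hf.concave hd hl (hΓ.symm (Equiv.swap i j) lam hl)
    rw [hf.symm _ _ hl] at h1
    have h2 : lam ∘ Equiv.swap i j - lam
        = (lam j - lam i) • ((Pi.single i 1 : Fin n → ℝ) - Pi.single j 1) := by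
      funext k
      by_cases hki : k = i
      · subst hki; simp [hne]
      · by_cases hkj : k = j
        · subst hkj; simp [hki]
        · simp [hki, hkj, Equiv.swap_apply_of_ne_of_ne hki hkj]
    rw [h2, map_smul, map_sub, ← aux_pder hd, ← aux_pder hd, smul_eq_mul] at h1
    have h3 : 0 ≤ (lam j - lam i) * (pder n f i lam - pder n f j lam) := by linarith
    have := nonneg_of_mul_nonneg_right h3 (by linarith)
    linarith
  · refine le_of_eq ?_
    unfold pder
    apply Filter.EventuallyEq.deriv_eq
    have hcont : Continuous (fun t : ℝ => (fun k => if k = i then lam k + t else lam k : Fin n → ℝ)) := by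
      refine continuous_pi fun k => ?_
      split_ifs <;> fun_prop
    have hmem : ∀ᶠ t : ℝ in nhds 0, (fun k => if k = i then lam k + t else lam k : Fin n → ℝ) ∈ Γ := by
      refine hcont.continuousAt.eventually_mem (hΓ.isOpen.mem_nhds ?_)
      simpa using hl
    filter_upwards [hmem] with t ht
    rw [← hf.symm (Equiv.swap i j) _ ht]
    congr 1
    funext k
    by_cases hki : k = i
    · subst hki; simp [hne, hne.symm, heq]
    · by_cases hkj : k = j
      · subst hkj; simp [heq]
      · simp [hki, hkj, Equiv.swap_apply_of_ne_of_ne hki hkj]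

/-- Proposition 2.3 (indices written in 0-based form: `f_1 = pder f 0`,
`f_{κ_Γ+1} = pder f κ_Γ`, `α_1 = α 0`). -/
theorem stmt_4 (n : ℕ) (hn : 2 ≤ n) (Γ : Set (Fin n → ℝ)) (hΓ : IsGoodCone n Γ)
    (hΓn : Γ ≠ gardingCone n n)
    (f : (Fin n → ℝ) → ℝ) (hf : IsGoodF n Γ f) (h18 : Cond18 n Γ f)
    (hκ : kappa n Γ < n)
    (α : Fin n → ℝ) (hαpos : ∀ i, 0 < α i)
    (hαΓ : (fun i : Fin n => if (i : ℕ) < kappa n Γ then -α i else α i) ∈ Γ)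
    (hαmono : ∀ i j : Fin n, (j : ℕ) < kappa n Γ → i ≤ j → α j ≤ α i)
    (lam : Fin n → ℝ) (hlam : lam ∈ Γ) (hmono : Monotone lam) :
    (α ⟨0, by omega⟩ /
        ((∑ i ∈ Finset.univ.filter (fun i : Fin n => kappa n Γ ≤ (i : ℕ)), α i) -
          ∑ i ∈ Finset.univ.filter (fun i : Fin n => 1 ≤ (i : ℕ) ∧ (i : ℕ) < kappa n Γ), α i))
        * pder n f ⟨0, by omega⟩ lam ≤ pder n f ⟨kappa n Γ, hκ⟩ lam ∧
    (1 / (n : ℝ)) * ∑ i, pder n f i lam ≤ pder n f ⟨0, by omega⟩ lam := by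
  have hd : DifferentiableAt ℝ f lam :=
    (hf.smooth.contDiffAt (hΓ.isOpen.mem_nhds hlam)).differentiableAt (by simp)
  have hanti : ∀ i j : Fin n, i ≤ j → pder n f j lam ≤ pder n f i lam :=
    fun i j h => aux_anti hΓ hf hd hlam (hmono h)
  have hn0 : (0 : ℝ) < n := by
    have : 0 < n := by omega
    exact_mod_cast this
  have hzero : ∀ j : Fin n, pder n f j lam ≤ pder n f ⟨0, by omega⟩ lam :=
    fun j => hanti _ _ (Fin.mk_le_of_le_val (Nat.zero_le _))
  refine ⟨?_, ?_⟩
  · have hnn := aux_nonneg hΓ hf.concave h18 hd hlam hαΓ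
    rw [aux_lin hd] at hnn
    have hsum := hΓ.subset_cone_one hαΓ 1 le_rfl le_rfl
    simp only [esymmR, Finset.powersetCard_one, Finset.sum_map, Function.Embedding.coeFn_mk,
      Finset.prod_singleton] at hsum
    generalize hk : kappa n Γ = κ at *
    set z : Fin n := ⟨0, by omega⟩ with hz
    set q : Fin n := ⟨κ, hκ⟩ with hq
    have hα0 := hαpos z
    rcases Nat.eq_zero_or_pos κ with h0 | hpos
    · subst h0
      have hF : ∑ i ∈ Finset.univ.filter (fun i : Fin n => 1 ≤ (i : ℕ) ∧ (i : ℕ) < 0), α i = 0 := by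
        simp
      have hG : ∑ i ∈ Finset.univ.filter (fun i : Fin n => 0 ≤ (i : ℕ)), α i = ∑ i, α i := by
        simp
      rw [hF, hG, sub_zero]
      simp only [Nat.not_lt_zero, if_false] at hnn hsum
      have h1 : ∑ i, α i * pder n f i lam ≤ ∑ i, α i * pder n f z lam :=
        Finset.sum_le_sum fun i _ => mul_le_mul_of_nonneg_left (hzero i) (hαpos i).le
      rw [← Finset.sum_mul] at h1
      have h2 : 0 ≤ pder n f z lam := nonneg_of_mul_nonneg_right (hnn.trans h1) hsum
      have h3 : α z / ∑ i, α i ≤ 1 := by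
        rw [div_le_one hsum]
        exact Finset.single_le_sum (fun i _ => (hαpos i).le) (Finset.mem_univ z)
      exact mul_le_of_le_one_left h2 h3
    · set A := ∑ i ∈ Finset.univ.filter (fun i : Fin n => κ ≤ (i : ℕ)), α i with hA
      set B := ∑ i ∈ Finset.univ.filter (fun i : Fin n => 1 ≤ (i : ℕ) ∧ (i : ℕ) < κ), α i with hB
      have key : ∀ g : Fin n → ℝ, ∑ i : Fin n, (if (i : ℕ) < κ then -α i else α i) * g i
          = ∑ i ∈ Finset.univ.filter (fun i : Fin n => κ ≤ (i : ℕ)), α i * g i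
            - ∑ i ∈ Finset.univ.filter (fun i : Fin n => 1 ≤ (i : ℕ) ∧ (i : ℕ) < κ), α i * g i
            - α z * g z := by
        intro g
        have hzs : α z * g z = ∑ i, if i = z then α i * g i else 0 := by simp
        rw [hzs, Finset.sum_filter, Finset.sum_filter, ← Finset.sum_sub_distrib,
          ← Finset.sum_sub_distrib]
        refine Finset.sum_congr rfl fun i _ => ?_
        have hiz : i = z ↔ (i : ℕ) = 0 := by rw [hz, Fin.ext_iff]
        simp only [hiz]
        split_ifs <;> first | (exfalso; omega) | ring
      have hsum2 := key (fun _ => 1)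
      simp only [mul_one] at hsum2
      rw [hsum2] at hsum
      rw [key] at hnn
      have h1 : ∑ i ∈ Finset.univ.filter (fun i : Fin n => κ ≤ (i : ℕ)), α i * pder n f i lam
          ≤ A * pder n f q lam := by
        rw [hA, Finset.sum_mul]
        refine Finset.sum_le_sum fun i hi => mul_le_mul_of_nonneg_left (hanti _ _ ?_) (hαpos i).le
        simpa [hq, Fin.le_def] using hi
      have h2 : B * pder n f q lam ≤ ∑ i ∈ Finset.univ.filter
          (fun i : Fin n => 1 ≤ (i : ℕ) ∧ (i : ℕ) < κ), α i * pder n f i lam := by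
        rw [hB, Finset.sum_mul]
        refine Finset.sum_le_sum fun i hi => mul_le_mul_of_nonneg_left (hanti _ _ ?_) (hαpos i).le
        have := (Finset.mem_filter.mp hi).2
        rw [Fin.le_def]; exact this.2.le
      have hpos' : 0 < A - B := by linarith
      rw [div_mul_eq_mul_div, div_le_iff₀ hpos']
      linarith
  · rw [one_div, inv_mul_le_iff₀ hn0]
    calc ∑ i, pder n f i lam ≤ ∑ _i : Fin n, pder n f ⟨0, by omega⟩ lam :=
          Finset.sum_le_sum fun i _ => hzero i
      _ = _ := by simp

end
end

section
/- Let Γ ⊆ ℝⁿ be an open symmetric convex cone with vertex at the origin, ∂Γ ≠ ∅ and Γ_n ⊆ Γ ⊆ Γ_1. Define κ̃_Γ = max{l : (0,…,0,α_{l+1},…,α_n) ∈ Γ for some positive reals α_{l+1},…,α_n}. Then κ_Γ = κ̃_Γ. -/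
open Filter

noncomputable section

/-- Proposition 2.8: `κ_Γ = κ̃_Γ`, where `κ̃_Γ` is the largest `l` such that some
vector whose first `l` entries vanish and whose remaining entries are positive
belongs to `Γ`. -/
theorem stmt_10 (n : ℕ) (hn : 2 ≤ n) (Γ : Set (Fin n → ℝ)) (hΓ : IsGoodCone n Γ) :
    kappa n Γ = sSup {l : ℕ | ∃ α : Fin n → ℝ, (∀ i : Fin n, l ≤ (i : ℕ) → 0 < α i) ∧
      (fun i : Fin n => if (i : ℕ) < l then 0 else α i) ∈ Γ} := by
  unfold kappa
  congr 1
  ext l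
  simp only [Set.mem_ofPred_eq]
  constructor
  · rintro ⟨α, hα, hv⟩
    have hw : α ∈ Γ := by
      apply hΓ.posCone_subset
      intro j _ hj
      unfold esymmR
      apply Finset.sum_pos
      · intro s _
        exact Finset.prod_pos fun i _ => hα i
      · apply Finset.powersetCard_nonempty.2
        simpa using hj
    refine ⟨fun i => α i, fun i _ => hα i, ?_⟩
    have h := hΓ.convex hv hw (a := 1 / 2) (b := 1 / 2) (by norm_num) (by norm_num) (by norm_num)
    convert h using 1
    ext i
    simp only [Pi.add_apply, Pi.smul_apply, smul_eq_mul]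
    split_ifs <;> ring
  · rintro ⟨α, hα, hv⟩
    have hc : Continuous (fun (ε : ℝ) (i : Fin n) => if (i : ℕ) < l then -ε else α i) := by
      refine continuous_pi fun i => ?_
      split_ifs <;> fun_prop
    have hO := hΓ.isOpen.preimage hc
    have h0 : (0 : ℝ) ∈ (fun (ε : ℝ) (i : Fin n) => if (i : ℕ) < l then -ε else α i) ⁻¹' Γ := by
      simpa using hv
    obtain ⟨δ, hδ, hb⟩ := Metric.isOpen_iff.1 hO 0 h0
    have hm : δ / 2 ∈ Metric.ball (0 : ℝ) δ := by
      rw [Metric.mem_ball, Real.dist_eq, sub_zero, abs_of_pos (by linarith)]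
      linarith
    have h := hb hm
    refine ⟨fun i => if (i : ℕ) < l then δ / 2 else α i, fun i => ?_, ?_⟩
    · dsimp only
      split_ifs with hi
      · linarith
      · exact hα i (not_lt.1 hi)
    · convert Set.mem_preimage.1 h using 1
      ext i
      split_ifs <;> simp_all

end
end

section
/- Let Γ ⊆ ℝⁿ be an open symmetric convex cone with vertex at the origin, ∂Γ ≠ ∅ and Γ_n ⊆ Γ ⊆ Γ_1. Then κ_Γ is well defined with 0 ≤ κ_Γ ≤ n − 1, and moreover κ_Γ ≥ 1 if and only if Γ ≠ Γ_n. -/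
open Filter

noncomputable section

theorem garding_pos_iff (n : ℕ) (lam : Fin n → ℝ) :
    lam ∈ gardingCone n n ↔ ∀ i, 0 < lam i := by
  constructor
  · intro h i
    by_contra hi
    push Not at hi
    have hn : 1 ≤ n := by have := i.2; omega
    have key : ∏ k, (lam k + (-lam i)) =
        ∑ j ∈ Finset.range (n + 1), esymmR n j lam * (-lam i) ^ (n - j) := by
      rw [Finset.prod_add, Finset.sum_powerset]
      simp only [Finset.card_univ, Fintype.card_fin]
      refine Finset.sum_congr rfl fun j _ => ?_
      unfold esymmR
      rw [Finset.sum_mul]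
      refine Finset.sum_congr rfl fun s hs => ?_
      rw [Finset.prod_const, Finset.card_sdiff_of_subset (Finset.subset_univ s),
        (Finset.mem_powersetCard.1 hs).2]
      simp
    have h0 : ∏ k, (lam k + (-lam i)) = 0 :=
      Finset.prod_eq_zero (Finset.mem_univ i) (by ring)
    have hp : 0 < ∑ j ∈ Finset.range (n + 1), esymmR n j lam * (-lam i) ^ (n - j) := by
      refine Finset.sum_pos' (fun j hj => ?_) ⟨n, by simp, ?_⟩
      · have hj' : j ≤ n := by simpa [Nat.lt_succ_iff] using hj
        refine mul_nonneg ?_ (pow_nonneg (by linarith) _)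
        rcases Nat.eq_zero_or_pos j with rfl | h1
        · simp [esymmR]
        · exact (h j h1 hj').le
      · simpa using h n hn le_rfl
    linarith
  · intro h j h1 hj
    unfold esymmR
    refine Finset.sum_pos (fun s _ => Finset.prod_pos fun i _ => h i) ?_
    exact Finset.powersetCard_nonempty.2 (by simpa using hj)

theorem garding_one (n : ℕ) (lam : Fin n → ℝ) (h : lam ∈ gardingCone n 1) :
    0 < ∑ i, lam i := by
  have := h 1 le_rfl le_rfl
  simpa [esymmR, Finset.powersetCard_one] using this

theorem cone_add (n : ℕ) (Γ : Set (Fin n → ℝ)) (hΓ : IsGoodCone n Γ) (a b : Fin n → ℝ)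
    (ha : a ∈ Γ) (hb : b ∈ Γ) : a + b ∈ Γ := by
  have := hΓ.convex (hΓ.cone 2 (by norm_num) a ha) (hΓ.cone 2 (by norm_num) b hb)
    (show (0:ℝ) ≤ 1/2 by norm_num) (show (0:ℝ) ≤ 1/2 by norm_num) (by norm_num)
  simpa [smul_smul] using this

theorem exists_neg (n : ℕ) (Γ : Set (Fin n → ℝ)) (hΓ : IsGoodCone n Γ) (a : Fin n → ℝ)
    (ha : a ∈ Γ) : ∃ e : ℝ, 0 < e ∧ (fun i => a i - e) ∈ Γ := by
  have hc : Continuous (fun e : ℝ => (fun i => a i - e : Fin n → ℝ)) := by fun_prop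
  have ho := hΓ.isOpen.preimage hc
  obtain ⟨r, hr, hb⟩ := Metric.isOpen_iff.1 ho 0 (by simpa using ha)
  refine ⟨r / 2, by linarith, hb ?_⟩
  simp [abs_of_pos hr, hr]

/-- Basic properties of `κ_Γ`: the defining set is nonempty and bounded above
(so `κ_Γ` is well defined), `0 ≤ κ_Γ ≤ n - 1`, and `κ_Γ ≥ 1 ↔ Γ ≠ Γ_n`. -/
theorem stmt_11 (n : ℕ) (hn : 2 ≤ n) (Γ : Set (Fin n → ℝ)) (hΓ : IsGoodCone n Γ) :
    ({l : ℕ | ∃ α : Fin n → ℝ, (∀ i, 0 < α i) ∧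
        (fun i : Fin n => if (i : ℕ) < l then -α i else α i) ∈ Γ}).Nonempty ∧
    BddAbove {l : ℕ | ∃ α : Fin n → ℝ, (∀ i, 0 < α i) ∧
        (fun i : Fin n => if (i : ℕ) < l then -α i else α i) ∈ Γ} ∧
    kappa n Γ ≤ n - 1 ∧
    (1 ≤ kappa n Γ ↔ Γ ≠ gardingCone n n) := by
  have hle : ∀ l ∈ {l : ℕ | ∃ α : Fin n → ℝ, (∀ i, 0 < α i) ∧
        (fun i : Fin n => if (i : ℕ) < l then -α i else α i) ∈ Γ}, l ≤ n - 1 := by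
    rintro l ⟨α, hα, hm⟩
    by_contra hl
    have h1 := garding_one n _ (hΓ.subset_cone_one hm)
    have h2 : ∑ i : Fin n, (if (i : ℕ) < l then -α i else α i) ≤ 0 := by
      refine Finset.sum_nonpos fun i _ => ?_
      have := i.2
      rw [if_pos (by omega)]
      linarith [hα i]
    linarith
  have hne : ({l : ℕ | ∃ α : Fin n → ℝ, (∀ i, 0 < α i) ∧
        (fun i : Fin n => if (i : ℕ) < l then -α i else α i) ∈ Γ}).Nonempty :=
    ⟨0, fun _ => 1, fun _ => one_pos,
      hΓ.posCone_subset ((garding_pos_iff n _).2 fun i => by simp)⟩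
  have hbd : BddAbove {l : ℕ | ∃ α : Fin n → ℝ, (∀ i, 0 < α i) ∧
        (fun i : Fin n => if (i : ℕ) < l then -α i else α i) ∈ Γ} := ⟨n - 1, hle⟩
  have hmem := Nat.sSup_mem hne hbd
  refine ⟨hne, hbd, hle _ hmem, ?_, ?_⟩
  · intro hk heq
    obtain ⟨α, hα, hm⟩ := hmem
    change 1 ≤ sSup _ at hk
    rw [heq] at hk
    rw [heq, garding_pos_iff] at hm
    have h0 := hm ⟨0, by omega⟩
    rw [if_pos (by exact hk)] at h0
    linarith [hα ⟨0, by omega⟩]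
  · intro hneq
    have : ∃ lam ∈ Γ, lam ∉ gardingCone n n := by
      by_contra hcon
      push Not at hcon
      exact hneq (Set.Subset.antisymm hcon hΓ.posCone_subset)
    obtain ⟨lam, hlam, hnot⟩ := this
    rw [garding_pos_iff] at hnot
    push Not at hnot
    obtain ⟨i, hi⟩ := hnot
    obtain ⟨e, he, hm⟩ := exists_neg n Γ hΓ lam hlam
    have hs := hΓ.symm (Equiv.swap ⟨0, by omega⟩ i) _ hm
    set mu := (fun i => lam i - e) ∘ (Equiv.swap (⟨0, by omega⟩ : Fin n) i) with hmu
    have hmu0 : mu ⟨0, by omega⟩ < 0 := by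
      simp only [hmu, Function.comp, Equiv.swap_apply_left]
      linarith
    have hv : (fun j : Fin n => if (j : ℕ) < 1 then -mu j / 2 else |mu j| + 1) ∈ Γ := by
      refine hΓ.posCone_subset ((garding_pos_iff n _).2 fun j => ?_)
      split_ifs with h
      · have : j = ⟨0, by omega⟩ := Fin.ext (by simpa using h)
        rw [this]; linarith
      · positivity
    refine le_csSup hbd ⟨fun j => if (j : ℕ) < 1 then -mu j / 2 else mu j + (|mu j| + 1), ?_, ?_⟩
    · intro j
      dsimp only
      split_ifs with h
      · have : j = ⟨0, by omega⟩ := Fin.ext (by simpa using h)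
        rw [this]; linarith
      · linarith [neg_abs_le (mu j)]
    · convert cone_add n Γ hΓ _ _ hs hv using 1
      funext j
      simp only [Pi.add_apply]
      split_ifs <;> ring

end
end

section
/- For every 1 ≤ k ≤ n, the k-th Gårding cone Γ_k satisfies κ_{Γ_k} = n − k. -/
open Filter

noncomputable section

/-- Elementary symmetric sum over a finset. -/
def eS {n : ℕ} (lam : Fin n → ℝ) (S : Finset (Fin n)) (j : ℕ) : ℝ :=
  ∑ s ∈ S.powersetCard j, ∏ i ∈ s, lam i

lemma eS_insert {n : ℕ} (lam : Fin n → ℝ) (S : Finset (Fin n)) (a : Fin n) (ha : a ∉ S) (j : ℕ) :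
    eS lam (insert a S) (j+1) = eS lam S (j+1) + lam a * eS lam S j := by
  unfold eS
  rw [Finset.powersetCard_succ_insert ha, Finset.sum_union]
  · congr 1
    rw [Finset.sum_image, Finset.mul_sum]
    · apply Finset.sum_congr rfl
      intro s hs
      rw [Finset.prod_insert]
      exact fun h => ha ((Finset.mem_powersetCard.1 hs).1 h)
    · intro s hs t ht h
      have h1 : a ∉ s := fun h => ha ((Finset.mem_powersetCard.1 hs).1 h)
      have h2 : a ∉ t := fun h => ha ((Finset.mem_powersetCard.1 ht).1 h)
      have h' : insert a s = insert a t := h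
      rw [← Finset.erase_insert h1, h', Finset.erase_insert h2]
  · rw [Finset.disjoint_left]
    intro s hs hs'
    obtain ⟨t, _, rfl⟩ := Finset.mem_image.1 hs'
    exact ha ((Finset.mem_powersetCard.1 hs).1 (Finset.mem_insert_self _ _))

lemma eS_zero {n : ℕ} (lam : Fin n → ℝ) (S : Finset (Fin n)) : eS lam S 0 = 1 := by
  simp [eS]

lemma eS_remove {n : ℕ} (lam : Fin n → ℝ) (k : ℕ) (S T : Finset (Fin n)) (hd : Disjoint T S)
    (hneg : ∀ i ∈ T, lam i < 0) (h : ∀ j ≤ k, 0 < eS lam (T ∪ S) j) :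
    ∀ j ≤ k, 0 < eS lam S j := by
  induction T using Finset.induction_on with
  | empty => simpa using h
  | insert a T ha ih =>
    rw [Finset.disjoint_insert_left] at hd
    refine ih hd.2 (fun i hi => hneg i (Finset.mem_insert_of_mem hi)) ?_
    have hna : a ∉ T ∪ S := by simp [ha, hd.1]
    intro j
    induction j with
    | zero => intro _; rw [eS_zero]; exact one_pos
    | succ j ihj =>
      intro hj
      have h1 := h (j+1) hj
      rw [Finset.insert_union, eS_insert _ _ _ hna] at h1
      have h2 := ihj (by omega)
      have h3 := hneg a (Finset.mem_insert_self _ _)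
      nlinarith [mul_pos (neg_pos.2 h3) h2]

lemma kappa_upper (n k l : ℕ) (hk : 1 ≤ k) (hkn : k ≤ n) (α : Fin n → ℝ) (hα : ∀ i, 0 < α i)
    (h : (fun i : Fin n => if (i : ℕ) < l then -α i else α i) ∈ gardingCone n k) : l ≤ n - k := by
  by_contra hl
  set lam : Fin n → ℝ := fun i : Fin n => if (i : ℕ) < l then -α i else α i with hlam
  have key := eS_remove lam k (Finset.univ.filter fun i : Fin n => ¬ (i : ℕ) < l)
    (Finset.univ.filter fun i : Fin n => (i : ℕ) < l)
    (Finset.disjoint_filter_filter_not _ _ _) (by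
      intro i hi
      have : (i : ℕ) < l := by simpa using hi
      simp [hlam, this, hα i]) (by
      intro j hj
      rw [Finset.filter_union_filter_not_eq]
      rcases Nat.eq_zero_or_pos j with rfl | hj0
      · rw [eS_zero]; exact one_pos
      · exact h j hj0 hj) k le_rfl
  have hc : (Finset.univ.filter fun i : Fin n => ¬ (i : ℕ) < l).card ≤ n - l := by
    rw [← Nat.card_Ico]
    apply Finset.card_le_card_of_injOn (fun i : Fin n => (i : ℕ))
    · intro i hi
      have : l ≤ (i : ℕ) := by simpa using hi
      simp [this]
    · exact fun a _ b _ h => Fin.ext h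
  rw [eS, Finset.powersetCard_eq_empty.2 (by omega)] at key
  simp at key

lemma kappa_lower (n k : ℕ) (hkn : k ≤ n) : ∃ α : Fin n → ℝ, (∀ i, 0 < α i) ∧
    (fun i : Fin n => if (i : ℕ) < n - k then -α i else α i) ∈ gardingCone n k := by
  let v : ℝ → Fin n → ℝ := fun e i => if (i : ℕ) < n - k then -e else 1
  have hcard : k ≤ (Finset.univ.filter fun i : Fin n => ¬ (i : ℕ) < n - k).card := by
    have h1 : (Finset.univ.filter fun i : Fin n => (i : ℕ) < n - k).card ≤ n - k := by
      rw [← Finset.card_range (n - k)]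
      apply Finset.card_le_card_of_injOn (fun i : Fin n => (i : ℕ))
      · intro i hi
        simpa using hi
      · exact fun a _ b _ h => Fin.ext h
    have h2 := Finset.card_filter_add_card_filter_not (s := (Finset.univ : Finset (Fin n)))
      (fun i : Fin n => (i : ℕ) < n - k)
    simp only [Finset.card_univ, Fintype.card_fin] at h2
    omega
  have hpos : ∀ j ≤ k, 0 < esymmR n j (v 0) := by
    intro j hj
    obtain ⟨s, hs, hsc⟩ := Finset.exists_subset_card_eq (hj.trans hcard)
    apply Finset.sum_pos'
    · intro t _
      apply Finset.prod_nonneg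
      intro i _
      simp only [v]; split_ifs <;> simp
    · refine ⟨s, by simp [hsc], ?_⟩
      apply Finset.prod_pos
      intro i hi
      have := (Finset.mem_filter.1 (hs hi)).2
      simp [v, this]
  have hcont : ∀ j, Continuous fun e => esymmR n j (v e) := by
    intro j
    unfold esymmR
    refine continuous_finsetSum _ fun s _ => continuous_finsetProd _ fun i _ => ?_
    simp only [v]; split_ifs <;> fun_prop
  have hev : ∀ᶠ e in nhds (0:ℝ), ∀ j ∈ Finset.range (k+1), 0 < esymmR n j (v e) := by
    rw [Filter.eventually_all_finset]
    intro j hj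
    exact (hcont j).continuousAt.eventually_const_lt (hpos j (by simpa [Nat.lt_succ_iff] using hj))
  obtain ⟨d, hd, hd'⟩ := Metric.eventually_nhds_iff.1 hev
  have h2 := hd' (y := d/2) (by simp [abs_of_pos hd]; linarith)
  refine ⟨fun i => if (i : ℕ) < n - k then d/2 else 1, ?_, ?_⟩
  · intro i; dsimp only; split_ifs <;> linarith
  · intro j _ hj
    have h3 := h2 j (by simp; omega)
    convert h3 using 2
    ext i
    simp only [v]; split_ifs <;> rfl

/-- `κ_{Γ_k} = n - k` for every `1 ≤ k ≤ n`. -/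
theorem stmt_12 (n : ℕ) (hn : 2 ≤ n) :
    ∀ k : ℕ, 1 ≤ k → k ≤ n → kappa n (gardingCone n k) = n - k := by
  intro k hk hkn
  have hmem := kappa_lower n k hkn
  have hub : ∀ l ∈ {l : ℕ | ∃ α : Fin n → ℝ, (∀ i, 0 < α i) ∧
    (fun i : Fin n => if (i : ℕ) < l then -α i else α i) ∈ gardingCone n k}, l ≤ n - k := by
    rintro l ⟨α, hα, h⟩
    exact kappa_upper n k l hk hkn α hα h
  exact IsGreatest.csSup_eq ⟨hmem, hub⟩

end
end

section
/- Let Γ ⊆ ℝⁿ be an open symmetric convex cone with vertex at the origin, ∂Γ ≠ ∅, Γ_n ⊆ Γ ⊆ Γ_1, and suppose Γ ≠ Γ_n. Then there exists a constant ϑ_Γ > 0 depending only on Γ such that for every smooth symmetric concave function f : Γ → ℝ satisfying condition (1.8), every λ ∈ Γ, and every index 1 ≤ i ≤ n, one has f_i(λ) ≤ (1 − κ_Γ·ϑ_Γ) Σ_{j=1}^n f_j(λ). -/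
open Filter

noncomputable section

lemma pos_mem_cone (n : ℕ) (v : Fin n → ℝ) (hv : ∀ i, 0 < v i) : v ∈ gardingCone n n := by
  intro j _ hj
  unfold esymmR
  apply Finset.sum_pos
  · intro s _
    exact Finset.prod_pos fun i _ => hv i
  · apply Finset.powersetCard_nonempty.2
    simpa using hj

lemma pder_eq (n : ℕ) (f : (Fin n → ℝ) → ℝ) (lam : Fin n → ℝ) (hf : DifferentiableAt ℝ f lam)
    (i : Fin n) : pder n f i lam = fderiv ℝ f lam (Pi.single i 1) := by
  unfold pder
  have h1 : (fun t : ℝ => f (fun j => if j = i then lam j + t else lam j))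
      = fun t : ℝ => f (lam + t • (Pi.single i 1 : Fin n → ℝ)) := by
    funext t
    congr 1
    funext j
    by_cases h : j = i
    · subst h; simp
    · simp [h]
  rw [h1]
  exact (hf.hasFDerivAt.hasLineDerivAt (Pi.single i 1)).lineDeriv

lemma fderiv_eq_coord_sum (n : ℕ) (f : (Fin n → ℝ) → ℝ) (lam : Fin n → ℝ) (hf : DifferentiableAt ℝ f lam)
    (μ : Fin n → ℝ) : fderiv ℝ f lam μ = ∑ j, μ j * pder n f j lam := by
  conv_lhs => rw [pi_eq_sum_univ' μ]
  rw [map_sum]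
  refine Finset.sum_congr rfl fun j _ => ?_
  rw [map_smul, pder_eq n f lam hf j, smul_eq_mul]

lemma tangent (n : ℕ) (Γ : Set (Fin n → ℝ)) (f : (Fin n → ℝ) → ℝ) (hc : ConcaveOn ℝ Γ f)
    (lam μ : Fin n → ℝ) (hl : lam ∈ Γ) (hm : μ ∈ Γ) (hf : DifferentiableAt ℝ f lam) :
    f μ ≤ f lam + fderiv ℝ f lam (μ - lam) := by
  have h1 := hc.comp_affineMap (AffineMap.lineMap (k := ℝ) lam μ)
  have h2 : HasDerivAt (f ∘ (AffineMap.lineMap (k := ℝ) lam μ)) (fderiv ℝ f lam (μ - lam)) 0 := by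
    have h3 : HasDerivAt (AffineMap.lineMap (k := ℝ) lam μ) (μ - lam) 0 :=
      AffineMap.hasDerivAt_lineMap
    have h4 : HasFDerivAt f (fderiv ℝ f lam) (AffineMap.lineMap (k := ℝ) lam μ 0) := by
      simpa using hf.hasFDerivAt
    exact h4.comp_hasDerivAt 0 h3
  have h5 := h1.slope_le_of_hasDerivAt (x := 0) (y := 1) (by simpa using hl) (by simpa using hm)
    one_pos h2
  simp [slope_def_field] at h5
  rw [map_sub]
  linarith

lemma fderiv_nonneg (n : ℕ) (Γ : Set (Fin n → ℝ)) (hΓ : IsGoodCone n Γ) (f : (Fin n → ℝ) → ℝ)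
    (hF : IsGoodF n Γ f) (h18 : Cond18 n Γ f)
    (lam μ : Fin n → ℝ) (hl : lam ∈ Γ) (hm : μ ∈ Γ) (hf : DifferentiableAt ℝ f lam) :
    0 ≤ fderiv ℝ f lam μ := by
  by_contra! hneg
  have h1 := h18 (f lam - 1) ⟨lam, hl, by linarith⟩ μ hm
  have h2 : Tendsto (fun t : ℝ => t * fderiv ℝ f lam μ) atTop atBot :=
    tendsto_id.atTop_mul_const_of_neg hneg
  have h3 := h2.eventually_lt_atBot (fderiv ℝ f lam lam - 1)
  obtain ⟨t, ht1, ht2, ht3⟩ := (h1.and (h3.and (eventually_gt_atTop 0))).exists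
  have h4 := tangent n Γ f hF.concave lam (t • μ) hl (hΓ.cone t ht3 μ hm) hf
  rw [map_sub, map_smul, smul_eq_mul] at h4
  linarith

lemma pder_nonneg (n : ℕ) (Γ : Set (Fin n → ℝ)) (hΓ : IsGoodCone n Γ) (f : (Fin n → ℝ) → ℝ)
    (hF : IsGoodF n Γ f) (h18 : Cond18 n Γ f)
    (lam : Fin n → ℝ) (hl : lam ∈ Γ) (hf : DifferentiableAt ℝ f lam) (i : Fin n) :
    0 ≤ pder n f i lam := by
  rw [pder_eq n f lam hf]
  set D := fderiv ℝ f lam with hD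
  have key : ∀ ε : ℝ, 0 < ε → 0 ≤ D (Pi.single i 1) + ε * D (fun _ => 1) := by
    intro ε hε
    have := fderiv_nonneg n Γ hΓ f hF h18 lam (Pi.single i 1 + ε • (fun _ => 1)) hl
      (hΓ.posCone_subset (pos_mem_cone n _ fun j => by
        by_cases h : j = i
        · subst h; simp; linarith
        · simp [h, hε])) hf
    rwa [map_add, map_smul, smul_eq_mul] at this
  by_contra! hneg
  have h1 : 0 ≤ D (fun _ => 1) := fderiv_nonneg n Γ hΓ f hF h18 lam _ hl
      (hΓ.posCone_subset (pos_mem_cone n _ fun j => one_pos)) hf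
  have hp : 0 < D (fun _ => 1) + 1 := by linarith
  have h2 := key (-D (Pi.single i 1) / (D (fun _ => 1) + 1)) (div_pos (by linarith) hp)
  have h3 : -D (Pi.single i 1) / (D (fun _ => 1) + 1) * (D (fun _ => 1) + 1)
    = -D (Pi.single i 1) := div_mul_cancel₀ _ hp.ne'
  have h4 : 0 < -D (Pi.single i 1) / (D (fun _ => 1) + 1) := div_pos (by linarith) hp
  nlinarith

lemma kappa_mem (n : ℕ) (hn : 2 ≤ n) (Γ : Set (Fin n → ℝ)) (hΓ : IsGoodCone n Γ) :
    ∃ α : Fin n → ℝ, (∀ i, 0 < α i) ∧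
    (fun i : Fin n => if (i : ℕ) < kappa n Γ then -α i else α i) ∈ Γ := by
  have := Nat.sSup_mem (s := {l : ℕ | ∃ α : Fin n → ℝ, (∀ i, 0 < α i) ∧
    (fun i : Fin n => if (i : ℕ) < l then -α i else α i) ∈ Γ}) ?_ ?_
  · exact this
  · refine ⟨0, fun _ => 1, fun _ => one_pos, hΓ.posCone_subset (pos_mem_cone n _ fun j => ?_)⟩
    simp
  · refine ⟨n, ?_⟩
    rintro l ⟨α, hα, hm⟩
    by_contra! hl
    have h := hΓ.subset_cone_one hm 1 le_rfl le_rfl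
    simp only [esymmR, Finset.powersetCard_one, Finset.sum_map, Function.Embedding.coeFn_mk,
      Finset.prod_singleton] at h
    apply absurd h
    push Not
    apply Finset.sum_nonpos
    intro i _
    have : (i : ℕ) < l := i.2.trans hl
    simp [this, (hα i).le]

/-- If `Γ ≠ Γ_n`, there is `ϑ_Γ > 0` depending only on `Γ` such that every `f`
satisfying (1.2) and (1.8) obeys `f_i(λ) ≤ (1 - κ_Γ ϑ_Γ) Σ_j f_j(λ)` on `Γ`. -/
theorem stmt_16 (n : ℕ) (hn : 2 ≤ n) (Γ : Set (Fin n → ℝ)) (hΓ : IsGoodCone n Γ)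
    (hΓn : Γ ≠ gardingCone n n) :
    ∃ ϑ : ℝ, 0 < ϑ ∧ ∀ f : (Fin n → ℝ) → ℝ, IsGoodF n Γ f → Cond18 n Γ f →
      ∀ lam ∈ Γ, ∀ i : Fin n,
        pder n f i lam ≤ (1 - (kappa n Γ : ℝ) * ϑ) * ∑ j, pder n f j lam := by
  have hdiff : ∀ f : (Fin n → ℝ) → ℝ, IsGoodF n Γ f → ∀ lam ∈ Γ, DifferentiableAt ℝ f lam :=
    fun f hF lam hl =>
      (hF.smooth.contDiffAt (hΓ.isOpen.mem_nhds hl)).differentiableAt (by simp)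
  obtain ⟨α, hα, hm⟩ := kappa_mem n hn Γ hΓ
  rcases Nat.eq_zero_or_pos (kappa n Γ) with h0 | hk
  · refine ⟨1, one_pos, fun f hF h18 lam hl i => ?_⟩
    rw [h0]
    simp only [Nat.cast_zero, zero_mul, sub_zero, one_mul]
    exact Finset.single_le_sum (f := fun j => pder n f j lam)
      (fun j _ => pder_nonneg n Γ hΓ f hF h18 lam hl (hdiff f hF lam hl) j) (Finset.mem_univ i)
  · set k := kappa n Γ with hkdef
    let z : Fin n := ⟨0, by omega⟩
    set M := ∑ j, α j with hM
    have hαM : ∀ j, α j ≤ M := fun j =>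
      Finset.single_le_sum (f := α) (fun j _ => (hα j).le) (Finset.mem_univ j)
    have ha : 0 < α z := hα z
    have hM0 : 0 < M := ha.trans_le (hαM z)
    have hk' : (0 : ℝ) < k := by exact_mod_cast hk
    refine ⟨α z / (k * (M + α z)), by positivity, fun f hF h18 lam hl i => ?_⟩
    have hd := hdiff f hF lam hl
    have hp := pder_nonneg n Γ hΓ f hF h18 lam hl hd
    have h1 := fderiv_nonneg n Γ hΓ f hF h18 lam _ hl (hΓ.symm (Equiv.swap z i) _ hm) hd
    rw [fderiv_eq_coord_sum n f lam hd] at h1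
    have h2 : ∀ j, ((fun i : Fin n => if (i : ℕ) < k then -α i else α i) ∘ (Equiv.swap z i)) j
        * pder n f j lam ≤ M * pder n f j lam
          - (if j = i then (M + α z) * pder n f j lam else 0) := by
      intro j
      by_cases h : j = i
      · subst h
        have : (z : ℕ) < k := hk
        simp only [Function.comp, Equiv.swap_apply_right, this, if_true]
        apply le_of_eq
        ring
      · rw [if_neg h, sub_zero]
        apply mul_le_mul_of_nonneg_right _ (hp j)
        simp only [Function.comp]
        split_ifs
        · linarith [hα (Equiv.swap z i j)]
        · exact hαM _
    have h3 := h1.trans (Finset.sum_le_sum fun j _ => h2 j)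
    rw [Finset.sum_sub_distrib, ← Finset.mul_sum, Finset.sum_ite_eq' Finset.univ i] at h3
    simp only [Finset.mem_univ, if_true] at h3
    have h4 : (1 - (k : ℝ) * (α z / (k * (M + α z)))) = M / (M + α z) := by
      field_simp
      ring
    rw [h4, div_mul_eq_mul_div, le_div_iff₀ (by positivity)]
    linarith

end
end

section
/- Let Γ ⊆ ℝⁿ be an open symmetric convex cone with vertex at the origin, ∂Γ ≠ ∅ and Γ_n ⊆ Γ ⊆ Γ_1, and define Γ̃ = {λ ∈ ℝⁿ : μ(λ) ∈ Γ}, where μ(λ)_i = Σ_{j≠i} λ_j. Then: if Γ ≠ Γ_n, κ_{Γ̃} = n − 1; while if Γ = Γ_n, κ_{Γ̃} = n − 2. -/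
open Filter

noncomputable section

lemma aux_pos_mem (n : ℕ) (x : Fin n → ℝ) (hx : ∀ i, 0 < x i) : x ∈ gardingCone n n := by
  intro j _ hj
  unfold esymmR
  apply Finset.sum_pos
  · intro s _
    exact Finset.prod_pos fun i _ => hx i
  · apply Finset.powersetCard_nonempty.mpr
    simpa using hj

lemma aux_mem_pos (n : ℕ) (x : Fin n → ℝ) (hx : x ∈ gardingCone n n) (i : Fin n) : 0 < x i := by
  by_contra h
  push Not at h
  have h0 : ∏ k, (x k + (-x i)) = 0 :=
    Finset.prod_eq_zero (Finset.mem_univ i) (by ring)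
  rw [Finset.prod_add, Finset.sum_powerset] at h0
  have key : ∀ j ∈ Finset.range (Finset.univ (α := Fin n)).card.succ,
      ∑ t ∈ Finset.powersetCard j (Finset.univ : Finset (Fin n)),
        ((∏ k ∈ t, x k) * ∏ k ∈ Finset.univ \ t, (-x i)) = esymmR n j x * (-x i) ^ (n - j) := by
    intro j _
    unfold esymmR
    rw [Finset.sum_mul]
    refine Finset.sum_congr rfl fun t ht => ?_
    rw [Finset.prod_const, Finset.card_sdiff_of_subset (Finset.subset_univ _),
      (Finset.mem_powersetCard.mp ht).2]
    simp
  rw [Finset.sum_congr rfl key] at h0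
  have hn : 1 ≤ n := by have := i.2; omega
  have : 0 < ∑ j ∈ Finset.range (Finset.univ (α := Fin n)).card.succ,
      esymmR n j x * (-x i) ^ (n - j) := by
    refine Finset.sum_pos' (fun j hj => ?_) ⟨n, by simp, ?_⟩
    · refine mul_nonneg ?_ (pow_nonneg (by linarith) _)
      rcases Nat.eq_zero_or_pos j with rfl | hj0
      · simp [esymmR]
      · refine (hx j hj0 ?_).le
        simp at hj
        omega
    · simpa using hx n hn le_rfl
  linarith

lemma aux_sum (n : ℕ) (x : Fin n → ℝ) (hx : x ∈ gardingCone n 1) : 0 < ∑ i, x i := by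
  have := hx 1 le_rfl le_rfl
  simpa [esymmR, Finset.powersetCard_one] using this

lemma aux_add (n : ℕ) (Γ : Set (Fin n → ℝ)) (hΓ : IsGoodCone n Γ) (x y : Fin n → ℝ)
    (hx : x ∈ Γ) (hy : y ∈ Γ) : x + y ∈ Γ := by
  have h := hΓ.convex hx hy (a := 1/2) (b := 1/2) (by norm_num) (by norm_num) (by norm_num)
  have h2 := hΓ.cone 2 (by norm_num) _ h
  convert h2 using 1
  ext i
  simp
  ring

lemma aux_neg (n : ℕ) (Γ : Set (Fin n → ℝ)) (hΓ : IsGoodCone n Γ)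
    (hne : Γ ≠ gardingCone n n) (k : Fin n) : ∃ x ∈ Γ, x k < 0 := by
  have : ∃ x ∈ Γ, ∃ i, x i ≤ 0 := by
    by_contra hcon
    push Not at hcon
    exact hne (Set.Subset.antisymm (fun x hx => aux_pos_mem n x (hcon x hx)) hΓ.posCone_subset)
  obtain ⟨x, hx, i, hi⟩ := this
  have hc : Continuous (fun e : ℝ => fun j => x j - e) := by fun_prop
  have hop := hΓ.isOpen.preimage hc
  obtain ⟨e, he, hb⟩ := Metric.isOpen_iff.mp hop 0 (by simpa using hx)
  have hm : (fun j => x j - e / 2) ∈ Γ := by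
    have hball : e / 2 ∈ Metric.ball (0 : ℝ) e := by
      rw [Metric.mem_ball, Real.dist_eq, sub_zero, abs_of_pos (by linarith)]
      linarith
    exact hb hball
  refine ⟨_, hΓ.symm (Equiv.swap i k) _ hm, ?_⟩
  simp
  linarith

lemma aux_split (n : ℕ) (x : Fin n → ℝ) (c : Fin n) (a : ℝ) (h : ∀ j, j ≠ c → x j = a) :
    ∑ j, x j = x c + (n - 1) * a := by
  rw [← Finset.add_sum_erase _ _ (Finset.mem_univ c)]
  rw [Finset.sum_congr rfl (fun j hj => h j (Finset.ne_of_mem_erase hj))]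
  have := c.2
  simp [Finset.card_erase_of_mem]
  left
  rw [Nat.cast_sub (by omega)]
  simp

/-- (3.2): for `Γ̃ = {λ : μ(λ) ∈ Γ}` with `μ(λ)_i = Σ_{j≠i} λ_j`, one has
`κ_{Γ̃} = n - 1` if `Γ ≠ Γ_n`, while `κ_{Γ̃} = n - 2` if `Γ = Γ_n`. -/
theorem stmt_19 (n : ℕ) (hn : 2 ≤ n) (Γ : Set (Fin n → ℝ)) (hΓ : IsGoodCone n Γ) :
    (Γ ≠ gardingCone n n →
      kappa n {lam : Fin n → ℝ | (fun i => (∑ j, lam j) - lam i) ∈ Γ} = n - 1) ∧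
    (Γ = gardingCone n n →
      kappa n {lam : Fin n → ℝ | (fun i => (∑ j, lam j) - lam i) ∈ Γ} = n - 2) := by
  have hlast : n - 1 < n := by omega
  have hn' : (2 : ℝ) ≤ n := by exact_mod_cast hn
  constructor
  · intro hne
    refine IsGreatest.csSup_eq ⟨?_, ?_⟩
    · obtain ⟨x, hx, hxk⟩ := aux_neg n Γ hΓ hne ⟨n - 1, hlast⟩
      set k : Fin n := ⟨n - 1, hlast⟩ with hk
      set t : ℝ := n / (-x k) with ht
      have htp : 0 < t := div_pos (by linarith) (by linarith)
      have htk : t * x k = -n := by have := hxk.ne; rw [ht]; field_simp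
      set A : ℝ := n + ∑ i, |t * x i| with hA
      have hAi : ∀ i, n + t * x i ≤ A := by
        intro i
        have h1 := Finset.single_le_sum (f := fun i => |t * x i|) (fun i _ => abs_nonneg _)
          (Finset.mem_univ i)
        have h2 := le_abs_self (t * x i)
        linarith
      have hAp : 0 < A := by
        have : 0 ≤ ∑ i, |t * x i| := Finset.sum_nonneg fun i _ => abs_nonneg _
        linarith
      refine ⟨fun i => if (i : ℕ) < n - 1 then 1 else A, fun i => ?_, ?_⟩
      · dsimp only
        split_ifs
        · norm_num
        · exact hAp
      · set v : Fin n → ℝ := fun i => if (i : ℕ) < n - 1 then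
            -(if (i : ℕ) < n - 1 then 1 else A) else (if (i : ℕ) < n - 1 then 1 else A) with hv
        have hvk : v k = A := by simp [hv, hk]
        have hvo : ∀ j, j ≠ k → v j = -1 := by
          intro j hj
          have : (j : ℕ) < n - 1 := by
            have h1 := j.2
            have h2 : (j : ℕ) ≠ n - 1 := fun h => hj (Fin.ext h)
            omega
          simp [hv, this]
        have hs := aux_split n v k (-1) hvo
        have h1 := hΓ.cone t htp x hx
        have h2 : (fun i => (∑ j, v j) - v i - t * x i) ∈ Γ := by
          apply hΓ.posCone_subset
          apply aux_pos_mem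
          intro i
          by_cases hi : i = k
          · rw [hi, hs, hvk, htk]; linarith
          · rw [hs, hvk, hvo i hi]
            linarith [hAi i]
        have h3 := aux_add n Γ hΓ _ _ h1 h2
        change (fun i => (∑ j, v j) - v i) ∈ Γ
        convert h3 using 1
        ext i
        simp
    · rintro l ⟨α, hα, hm⟩
      by_contra hl
      push Not at hl
      have := aux_sum n _ (hΓ.subset_cone_one hm)
      have hneg : ∀ i : Fin n, (if (i : ℕ) < l then -α i else α i) = -α i := by
        intro i
        rw [if_pos]
        have := i.2
        omega
      simp only [hneg] at this
      rw [Finset.sum_sub_distrib] at this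
      have hp : 0 ≤ ∑ i, α i := Finset.sum_nonneg fun i _ => (hα i).le
      simp at this
      nlinarith
  · intro he
    subst he
    refine IsGreatest.csSup_eq ⟨?_, ?_⟩
    · refine ⟨fun i => if (i : ℕ) < n - 2 then 1 else n, fun i => ?_, ?_⟩
      · dsimp only
        split_ifs
        · norm_num
        · linarith
      · apply aux_pos_mem
        set v : Fin n → ℝ := fun i => if (i : ℕ) < n - 2 then
            -(if (i : ℕ) < n - 2 then 1 else (n : ℝ)) else (if (i : ℕ) < n - 2 then 1 else (n : ℝ))
          with hv
        have hge : ∀ i, -1 ≤ v i := by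
          intro i
          simp only [hv]
          split_ifs <;> linarith
        intro i
        change 0 < (∑ j, v j) - v i
        obtain ⟨m, hmi, hm⟩ : ∃ m : Fin n, m ≠ i ∧ v m = n := by
          by_cases hi : (i : ℕ) = n - 1
          · refine ⟨⟨n - 2, by omega⟩, fun h => ?_, by simp [hv]⟩
            have := congrArg Fin.val h
            simp at this
            omega
          · refine ⟨⟨n - 1, by omega⟩, fun h => ?_, ?_⟩
            · have := congrArg Fin.val h
              simp at this
              omega
            · have : ¬ (n - 1 < n - 2) := by omega
              simp [hv, this]
        have h1 : ∑ j, (v j + 1) = ∑ j, v j + n := by simp [Finset.sum_add_distrib]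
        have h2 := Finset.sum_le_sum_of_subset_of_nonneg (f := fun j => v j + 1)
          (Finset.subset_univ ({m, i} : Finset (Fin n))) (fun j _ _ => by linarith [hge j])
        rw [Finset.sum_pair hmi, h1] at h2
        linarith
    · rintro l ⟨α, hα, hm⟩
      by_contra hl
      push Not at hl
      have := aux_mem_pos n _ hm ⟨n - 1, hlast⟩
      rw [← Finset.add_sum_erase _ _ (Finset.mem_univ (⟨n - 1, hlast⟩ : Fin n))] at this
      have h2 : ∑ j ∈ Finset.univ.erase (⟨n - 1, hlast⟩ : Fin n),
          (if (j : ℕ) < l then -α j else α j) ≤ 0 := by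
        apply Finset.sum_nonpos
        intro j hj
        rw [if_pos]
        · linarith [hα j]
        · have h1 := j.2
          have h2 : (j : ℕ) ≠ n - 1 := fun h => Finset.ne_of_mem_erase hj (Fin.ext h)
          omega
      linarith

end
end
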